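/- Let m ≥ 0 and let Λ, μ₁, μ₂, μ₃, μ₄, α, β, σ, γ be nonnegative real numbers all bounded above by m. Define g* : ℝ⁴ → ℝ⁴ by g*(s,e,i,r) = (Λ − μ₁ s⁺ − α·h(s⁺,e⁺,i⁺,r⁺) + β r⁺, −μ₂ e⁺ + α·h(s⁺,e⁺,i⁺,r⁺) − σ e⁺, −μ₃ i⁺ + σ e⁺ − γ i⁺, −μ₄ r⁺ + γ i⁺ − β r⁺), where ξ⁺ = max(ξ,0). Then there exists a constant K ≥ 0 depending only on m (not on the particular coefficients) such that ‖g*(v) − g*(w)‖ ≤ K‖v − w‖ for all v, w ∈ ℝ⁴. -/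

import Mathlib

/-- The standard-incidence function of the SEIRS model:
`h (s,e,i,r) = s·i/(s+e+i+r)` when `s+e+i+r > 0`, and `0` when the sum is not positive. -/
noncomputable def seirsIncidence (s e i r : ℝ) : ℝ :=
  if 0 < s + e + i + r then s * i / (s + e + i + r) else 0

/-- The truncated SEIRS reaction vector field `g*`, obtained from the SEIRS reaction
terms by composing with the componentwise positive part `ξ⁺ = max ξ 0`. -/
noncomputable def seirsGStar (Λ μ₁ μ₂ μ₃ μ₄ α β σ γ : ℝ)
    (v : ℝ × ℝ × ℝ × ℝ) : ℝ × ℝ × ℝ × ℝ :=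
  let s := max v.1 0
  let e := max v.2.1 0
  let i := max v.2.2.1 0
  let r := max v.2.2.2 0
  (Λ - μ₁ * s - α * seirsIncidence s e i r + β * r,
   -μ₂ * e + α * seirsIncidence s e i r - σ * e,
   -μ₃ * i + σ * e - γ * i,
   -μ₄ * r + γ * i - β * r)

theorem seirs_h_bound (s e i r : ℝ) (hs : 0 ≤ s) (he : 0 ≤ e) (hi : 0 ≤ i) (hr : 0 ≤ r) :
    0 ≤ seirsIncidence s e i r ∧ seirsIncidence s e i r ≤ s := by
  unfold seirsIncidence
  split_ifs with h
  · refine ⟨by positivity, ?_⟩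
    rw [div_le_iff₀ h]
    nlinarith [mul_nonneg hs hs, mul_nonneg hs he, mul_nonneg hs hr]
  · exact ⟨le_rfl, hs⟩

theorem seirs_mul_bound (p x D : ℝ) (hp0 : 0 ≤ p) (hp : p ≤ 1) (hx : |x| ≤ D) : |p * x| ≤ D := by
  rw [abs_mul, abs_of_nonneg hp0]
  nlinarith [abs_nonneg x]

theorem seirs_h_lip (s e i r s' e' i' r' D : ℝ) (hs : 0 ≤ s) (he : 0 ≤ e) (hi : 0 ≤ i)
    (hr : 0 ≤ r) (hs' : 0 ≤ s') (he' : 0 ≤ e') (hi' : 0 ≤ i') (hr' : 0 ≤ r')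
    (ds : |s - s'| ≤ D) (de : |e - e'| ≤ D) (di : |i - i'| ≤ D) (dr : |r - r'| ≤ D) :
    |seirsIncidence s e i r - seirsIncidence s' e' i' r'| ≤ 6 * D := by
  have hD : 0 ≤ D := (abs_nonneg _).trans ds
  have b1 := seirs_h_bound s e i r hs he hi hr
  have b2 := seirs_h_bound s' e' i' r' hs' he' hi' hr'
  by_cases h : 0 < s + e + i + r
  · by_cases h' : 0 < s' + e' + i' + r'
    · have key : seirsIncidence s e i r - seirsIncidence s' e' i' r' =
          s / (s + e + i + r) * (i - i') +
          (i' / (s' + e' + i' + r')) * (s / (s + e + i + r)) *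
            ((s' + e' + i' + r') - (s + e + i + r)) +
          i' / (s' + e' + i' + r') * (s - s') := by
        unfold seirsIncidence
        rw [if_pos h, if_pos h']
        generalize s + e + i + r = N at *
        generalize s' + e' + i' + r' = N' at *
        field_simp
        ring
      have p0 : 0 ≤ s / (s + e + i + r) := by positivity
      have p1 : s / (s + e + i + r) ≤ 1 := by rw [div_le_one h]; linarith
      have q0 : 0 ≤ i' / (s' + e' + i' + r') := by positivity
      have q1 : i' / (s' + e' + i' + r') ≤ 1 := by rw [div_le_one h']; linarith
      have dN : |(s' + e' + i' + r') - (s + e + i + r)| ≤ 4 * D := by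
        rw [abs_le] at *
        constructor <;> linarith [ds.1, ds.2, de.1, de.2, di.1, di.2, dr.1, dr.2]
      have t1 := seirs_mul_bound _ _ _ p0 p1 di
      have t2 := seirs_mul_bound _ _ _ (mul_nonneg q0 p0) (mul_le_one₀ q1 p0 p1) dN
      have t3 := seirs_mul_bound _ _ _ q0 q1 ds
      rw [key]
      rw [abs_le] at t1 t2 t3 ⊢
      constructor <;> linarith [t1.1, t1.2, t2.1, t2.2, t3.1, t3.2]
    · rw [abs_le] at *
      have : s' = 0 := by linarith
      constructor <;> linarith [b1.1, b1.2, b2.1, b2.2, ds.1, ds.2]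
  · rw [abs_le] at *
    have : s = 0 := by linarith
    constructor <;> linarith [b1.1, b1.2, b2.1, b2.2, ds.1, ds.2]

theorem seirs_coef (m c x D : ℝ) (hc : c ∈ Set.Icc 0 m) (hx : |x| ≤ D) :
    -(m * D) ≤ c * x ∧ c * x ≤ m * D := by
  rw [← abs_le, abs_mul, abs_of_nonneg hc.1]
  exact mul_le_mul hc.2 hx (abs_nonneg _) (hc.1.trans hc.2)

/-- For coefficients that are nonnegative and bounded by `m`, the truncated SEIRS
reaction vector field `g*` is Lipschitz on `ℝ⁴`, with a Lipschitz constant `K`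
depending only on `m` and not on the particular coefficients. -/
theorem seirsGStar_lipschitz (m : ℝ) (hm : 0 ≤ m) :
    ∃ K : ℝ, 0 ≤ K ∧
      ∀ Λ μ₁ μ₂ μ₃ μ₄ α β σ γ : ℝ,
        Λ ∈ Set.Icc 0 m → μ₁ ∈ Set.Icc 0 m → μ₂ ∈ Set.Icc 0 m → μ₃ ∈ Set.Icc 0 m →
        μ₄ ∈ Set.Icc 0 m → α ∈ Set.Icc 0 m → β ∈ Set.Icc 0 m → σ ∈ Set.Icc 0 m →
        γ ∈ Set.Icc 0 m →
        ∀ v w : ℝ × ℝ × ℝ × ℝ,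
          ‖seirsGStar Λ μ₁ μ₂ μ₃ μ₄ α β σ γ v - seirsGStar Λ μ₁ μ₂ μ₃ μ₄ α β σ γ w‖
            ≤ K * ‖v - w‖ := by
  refine ⟨8 * m, by positivity, ?_⟩
  rintro Λ μ₁ μ₂ μ₃ μ₄ α β σ γ - h1 h2 h3 h4 ha hb hσ hγ ⟨s, e, i, r⟩ ⟨s', e', i', r'⟩
  obtain ⟨D, hDdef⟩ : ∃ D, D = ‖((s, e, i, r) : ℝ × ℝ × ℝ × ℝ) - (s', e', i', r')‖ := ⟨_, rfl⟩
  have hle := hDdef.ge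
  rw [← hDdef]
  simp only [Prod.mk_sub_mk, norm_prod_le_iff, Real.norm_eq_abs] at hle
  obtain ⟨ds, de, di, dr⟩ := hle
  have hD : 0 ≤ D := (abs_nonneg _).trans ds
  have hmD : 0 ≤ m * D := mul_nonneg hm hD
  replace ds := (abs_max_sub_max_le_abs s s' 0).trans ds
  replace de := (abs_max_sub_max_le_abs e e' 0).trans de
  replace di := (abs_max_sub_max_le_abs i i' 0).trans di
  replace dr := (abs_max_sub_max_le_abs r r' 0).trans dr
  have dh := seirs_h_lip _ _ _ _ _ _ _ _ D (le_max_right s 0) (le_max_right e 0)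
    (le_max_right i 0) (le_max_right r 0) (le_max_right s' 0) (le_max_right e' 0)
    (le_max_right i' 0) (le_max_right r' 0) ds de di dr
  have c1 := seirs_coef _ _ _ _ h1 ds
  have c2 := seirs_coef _ _ _ _ h2 de
  have c3 := seirs_coef _ _ _ _ h3 di
  have c4 := seirs_coef _ _ _ _ h4 dr
  have c5 := seirs_coef _ _ _ _ ha dh
  have c6 := seirs_coef _ _ _ _ hb dr
  have c7 := seirs_coef _ _ _ _ hσ de
  have c8 := seirs_coef _ _ _ _ hγ di
  simp only [seirsGStar, Prod.mk_sub_mk, norm_prod_le_iff, Real.norm_eq_abs, abs_le]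
  refine ⟨⟨?_, ?_⟩, ⟨?_, ?_⟩, ⟨?_, ?_⟩, ⟨?_, ?_⟩⟩ <;>
  linarith [c1.1, c1.2, c2.1, c2.2, c3.1, c3.2, c4.1, c4.2, c5.1, c5.2, c6.1, c6.2,
    c7.1, c7.2, c8.1, c8.2]
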